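/- Let a₀, a₁, c ∈ ℝ with c > 0, set A₀ = (a₀+a₁)/2, assume A₀ ≥ −1, let r = 2√2·(1 + √(1+A₀)), and assume for each i ∈ {0,1} that 0 < c²/4 + a_i − (c+2)r and 0 ≤ r² − 2(c+1)r − a_i. Then for every x, y ∈ [−r,r] and every z_v, w_v ∈ [−r,r], the system of equations c·w = −z² + c·z + a₀ − x − z_v and c·z = −w² + c·w + a₁ − y − w_v has exactly four solutions (z,w) in the square [−r,r]². -/

import Mathlib

open Polynomial in
theorem aux_upper (c P Q : ℝ) (hc : c > 0) (S : Set (ℝ × ℝ))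
    (hS : ∀ p ∈ S, c * p.2 = -p.1 ^ 2 + c * p.1 + P ∧ c * p.1 = -p.2 ^ 2 + c * p.2 + Q) :
    S.Finite ∧ S.ncard ≤ 4 := by
  let q : ℝ[X] := X ^ 4 + (C (-2 * c) * X ^ 3 + C (2 * c ^ 2 - 2 * P) * X ^ 2
    + C (2 * c * P) * X + C (P ^ 2 - c ^ 2 * P - c ^ 2 * Q))
  have hdeg : q.natDegree = 4 := by
    simp only [q]; compute_degree!
  have hq0 : q ≠ 0 := by
    intro h; rw [h] at hdeg; simp at hdeg
  have hinj : Set.InjOn Prod.fst S := by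
    rintro ⟨z, w⟩ h ⟨z', w'⟩ h' e
    have h1 := (hS _ h).1
    have h2 := (hS _ h').1
    simp only at e h1 h2
    subst e
    have : c * w = c * w' := by rw [h1, h2]
    rw [mul_left_cancel₀ hc.ne' this]
  have hsub : Prod.fst '' S ⊆ (q.roots.toFinset : Set ℝ) := by
    rintro _ ⟨⟨z, w⟩, h, rfl⟩
    obtain ⟨h1, h2⟩ := hS _ h
    simp only at h1 h2
    simp only [Finset.mem_coe, Multiset.mem_toFinset, mem_roots hq0, IsRoot.def]
    simp only [q, eval_add, eval_mul, eval_pow, eval_X, eval_C]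
    linear_combination (-(c * w) + z ^ 2 - c * z - P + c ^ 2) * h1 + c ^ 2 * h2
  have hfin : (Prod.fst '' S).Finite := (Finset.finite_toSet _).subset hsub
  refine ⟨hfin.of_finite_image hinj, ?_⟩
  rw [← Set.ncard_image_of_injOn hinj]
  calc _ ≤ ((q.roots.toFinset : Set ℝ)).ncard := Set.ncard_le_ncard hsub (Finset.finite_toSet _)
    _ = q.roots.toFinset.card := Set.ncard_coe_finset _
    _ ≤ Multiset.card q.roots := Multiset.toFinset_card_le _
    _ ≤ 4 := hdeg ▸ card_roots' q

theorem aux_range (c P r ε w : ℝ) (hc : c > 0) (hrc : c / 2 ≤ r)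
    (h1 : 0 < c ^ 2 / 4 + P - c * r) (h2 : P ≤ r ^ 2 - 2 * c * r) (he : ε = 1 ∨ ε = -1)
    (hw : w ∈ Set.Icc (-r) r) :
    0 < √(c ^ 2 / 4 + P - c * w) ∧ c / 2 + ε * √(c ^ 2 / 4 + P - c * w) ∈ Set.Icc (-r) r := by
  obtain ⟨hw1, hw2⟩ := hw
  have hp : 0 < c ^ 2 / 4 + P - c * w := by nlinarith
  have hs : √(c ^ 2 / 4 + P - c * w) ≤ r - c / 2 := by
    apply Real.sqrt_le_iff.2
    constructor
    · linarith
    · nlinarith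
  have hs0 := Real.sqrt_pos.2 hp
  refine ⟨hs0, ?_⟩
  rcases he with rfl | rfl <;> constructor <;> linarith

theorem aux_exists (c P Q r ε δ : ℝ) (hc : c > 0) (hrc : c / 2 ≤ r)
    (hP1 : 0 < c ^ 2 / 4 + P - c * r) (hP2 : P ≤ r ^ 2 - 2 * c * r)
    (hQ1 : 0 < c ^ 2 / 4 + Q - c * r) (hQ2 : Q ≤ r ^ 2 - 2 * c * r)
    (he : ε = 1 ∨ ε = -1) (hd : δ = 1 ∨ δ = -1) :
    ∃ z w : ℝ, z ∈ Set.Icc (-r) r ∧ w ∈ Set.Icc (-r) r ∧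
      c * w = -z ^ 2 + c * z + P ∧ c * z = -w ^ 2 + c * w + Q ∧
      0 < ε * (z - c / 2) ∧ 0 < δ * (w - c / 2) := by
  let F : ℝ → ℝ := fun w => c / 2 + ε * √(c ^ 2 / 4 + P - c * w)
  let G : ℝ → ℝ := fun z => c / 2 + δ * √(c ^ 2 / 4 + Q - c * z)
  have hF : ∀ w ∈ Set.Icc (-r) r, F w ∈ Set.Icc (-r) r := fun w hw =>
    (aux_range c P r ε w hc hrc hP1 hP2 he hw).2
  have hG : ∀ w ∈ Set.Icc (-r) r, G w ∈ Set.Icc (-r) r := fun w hw =>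
    (aux_range c Q r δ w hc hrc hQ1 hQ2 hd hw).2
  have hcont : Continuous (fun w => w - G (F w)) := by
    simp only [F, G]; fun_prop
  have hr : -r ≤ r := by linarith
  have := intermediate_value_Icc hr hcont.continuousOn
  obtain ⟨w, hw, hw0⟩ := this (show (0 : ℝ) ∈ _ from
    ⟨by have := (hG _ (hF (-r) ⟨le_rfl, hr⟩)).1; linarith,
     by have := (hG _ (hF r ⟨hr, le_rfl⟩)).2; linarith⟩)
  have hwG : w = G (F w) := by simp only at hw0; linarith
  have a1 := (aux_range c P r ε w hc hrc hP1 hP2 he hw).1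
  have a2 := (aux_range c Q r δ (F w) hc hrc hQ1 hQ2 hd (hF w hw)).1
  have s1 := Real.sq_sqrt (Real.sqrt_pos.1 a1).le
  have s2 := Real.sq_sqrt (Real.sqrt_pos.1 a2).le
  have hz : F w = c / 2 + ε * √(c ^ 2 / 4 + P - c * w) := rfl
  have hw' : w = c / 2 + δ * √(c ^ 2 / 4 + Q - c * F w) := hwG
  have e2 : ε ^ 2 = 1 := by rcases he with rfl | rfl <;> norm_num
  have d2 : δ ^ 2 = 1 := by rcases hd with rfl | rfl <;> norm_num
  refine ⟨F w, w, hF w hw, hw, ?_, ?_, ?_, ?_⟩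
  · generalize √(c ^ 2 / 4 + P - c * w) = s at *
    rw [hz]; linear_combination s1 + s ^ 2 * e2
  · generalize F w = z at *
    generalize √(c ^ 2 / 4 + Q - c * z) = s at *
    have : (w - c / 2) ^ 2 = s ^ 2 := by
      rw [show w - c / 2 = δ * s by linarith, mul_pow, d2, one_mul]
    linarith
  · have : ε * (F w - c / 2) = √(c ^ 2 / 4 + P - c * w) := by
      rw [hz]; linear_combination √(c ^ 2 / 4 + P - c * w) * e2
    rw [this]; exact a1
  · have : δ * (w - c / 2) = √(c ^ 2 / 4 + Q - c * F w) := by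
      linear_combination √(c ^ 2 / 4 + Q - c * F w) * d2 + δ * hw'
    rw [this]; exact a2


/-- in each fixed-(x,y) section plane, the two parabolas defined
by the third and fourth constraints of `f_III(d(v))` intersect in exactly four
points of the square `[-r,r]²`. -/
theorem stmt_10 (a₀ a₁ c : ℝ) (hc : c > 0)
    (A₀ : ℝ) (hA₀def : A₀ = (a₀ + a₁) / 2) (hA₀ : A₀ ≥ -1)
    (r : ℝ) (hr : r = 2 * Real.sqrt 2 * (1 + Real.sqrt (1 + A₀)))
    (hbound1 : ∀ i ∈ ({a₀, a₁} : Set ℝ), 0 < c ^ 2 / 4 + i - (c + 2) * r)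
    (hbound2 : ∀ i ∈ ({a₀, a₁} : Set ℝ), 0 ≤ r ^ 2 - 2 * (c + 1) * r - i) :
    ∀ x ∈ Set.Icc (-r) r, ∀ y ∈ Set.Icc (-r) r,
    ∀ z_v ∈ Set.Icc (-r) r, ∀ w_v ∈ Set.Icc (-r) r,
      {p : ℝ × ℝ | p.1 ∈ Set.Icc (-r) r ∧ p.2 ∈ Set.Icc (-r) r ∧
          c * p.2 = -p.1 ^ 2 + c * p.1 + a₀ - x - z_v ∧
          c * p.1 = -p.2 ^ 2 + c * p.2 + a₁ - y - w_v}.ncard = 4 := by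


  intro x hx y hy zv hzv wv hwv
  obtain ⟨hx1, hx2⟩ := hx
  obtain ⟨hy1, hy2⟩ := hy
  obtain ⟨hzv1, hzv2⟩ := hzv
  obtain ⟨hwv1, hwv2⟩ := hwv
  have b10 := hbound1 a₀ (by simp)
  have b11 := hbound1 a₁ (by simp)
  have b20 := hbound2 a₀ (by simp)
  have b21 := hbound2 a₁ (by simp)
  have hr2 : 2 ≤ r := by
    have h1 : (1 : ℝ) ≤ √2 := Real.one_le_sqrt.2 (by norm_num)
    have h2 := Real.sqrt_nonneg (1 + A₀)
    rw [hr]; nlinarith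
  have hrc : c / 2 ≤ r := by
    by_contra h
    push Not at h
    nlinarith
  set S := {p : ℝ × ℝ | p.1 ∈ Set.Icc (-r) r ∧ p.2 ∈ Set.Icc (-r) r ∧
          c * p.2 = -p.1 ^ 2 + c * p.1 + a₀ - x - zv ∧
          c * p.1 = -p.2 ^ 2 + c * p.2 + a₁ - y - wv} with hS
  obtain ⟨hfin, hle⟩ := aux_upper c (a₀ - x - zv) (a₁ - y - wv) hc S (by
    rintro p ⟨-, -, h1, h2⟩
    exact ⟨by linarith, by linarith⟩)
  have key : ∀ ε δ : ℝ, (ε = 1 ∨ ε = -1) → (δ = 1 ∨ δ = -1) →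
      ∃ p ∈ S, 0 < ε * (p.1 - c / 2) ∧ 0 < δ * (p.2 - c / 2) := by
    intro ε δ he hd
    obtain ⟨z, w, hz, hw, h1, h2, h3, h4⟩ := aux_exists c (a₀ - x - zv) (a₁ - y - wv) r ε δ hc hrc
      (by linarith) (by linarith) (by linarith) (by linarith) he hd
    exact ⟨(z, w), ⟨hz, hw, by simp only; linarith, by simp only; linarith⟩, h3, h4⟩
  obtain ⟨p1, m1, u1, v1⟩ := key 1 1 (by simp) (by simp)
  obtain ⟨p2, m2, u2, v2⟩ := key 1 (-1) (by simp) (by simp)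
  obtain ⟨p3, m3, u3, v3⟩ := key (-1) 1 (by simp) (by simp)
  obtain ⟨p4, m4, u4, v4⟩ := key (-1) (-1) (by simp) (by simp)
  have n12 : p1 ≠ p2 := by rintro rfl; linarith
  have n13 : p1 ≠ p3 := by rintro rfl; linarith
  have n14 : p1 ≠ p4 := by rintro rfl; linarith
  have n23 : p2 ≠ p3 := by rintro rfl; linarith
  have n24 : p2 ≠ p4 := by rintro rfl; linarith
  have n34 : p3 ≠ p4 := by rintro rfl; linarith
  have hcard : (({p1, p2, p3, p4} : Finset (ℝ × ℝ)) : Set (ℝ × ℝ)).ncard = 4 := by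
    rw [Set.ncard_coe_finset]
    simp [n12, n13, n14, n23, n24, n34]
  have hsub : (({p1, p2, p3, p4} : Finset (ℝ × ℝ)) : Set (ℝ × ℝ)) ⊆ S := by
    intro p hp
    simp only [Finset.coe_insert, Finset.coe_singleton, Set.mem_insert_iff,
      Set.mem_singleton_iff] at hp
    rcases hp with rfl | rfl | rfl | rfl <;> assumption
  have := Set.ncard_le_ncard hsub hfin
  omega
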